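/- Let α = 3 and c₃ = sqrt(12·ζ(3)). Let v: ℝ² → ℝ be smooth with square-integrable x-derivatives ∂_x^n v for 1 ≤ n ≤ 5 (square-integrable in x, uniformly in the second argument τ, with all these derivatives bounded and continuous), and set u = −∂_x v, Q(x,τ) = 2c₃·∂_τ u + 60·ζ(3)·u·∂_x u + ∂_x³ u. Then under the logarithmically corrected scaling ansatz X_ε(j,t) = j + ε·log(1/ε)·v(ε(j − c₃ t), ε³·log(1/ε)·t), the lattice error R_ε(x,τ) = ∂_t² X_ε(j,t) + 3·Σ_{m=1}^∞ [ (X_ε(j+m,t) − X_ε(j,t))^{−4} − (X_ε(j,t) − X_ε(j−m,t))^{−4} ] (with x = ε(j − c₃ t), τ = ε³ log(1/ε) t) satisfies R_ε(x,τ) = ε⁵·log²(1/ε)·(Q(x,τ) + o(1)) as ε → 0⁺, for each fixed (x,τ) ∈ ℝ². -/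

import Mathlib

open Real Filter Topology MeasureTheory

/-- `ζ(3) = Σ_{m=1}^∞ m^{-3}`. -/
noncomputable def zeta3 : ℝ := ∑' m : ℕ, ((m : ℝ) + 1) ^ (-(3 : ℝ))

/-- The sonic speed `c₃ = √(12 ζ(3))`. -/
noncomputable def c3 : ℝ := Real.sqrt (12 * zeta3)

/-- The logarithmically corrected long-wave ansatz
`X_ε(j,t) = j + ε log(1/ε) v(ε(j − c₃ t), ε³ log(1/ε) t)`. -/
noncomputable def ansatzLog (v : ℝ → ℝ → ℝ) (ε j t : ℝ) : ℝ :=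
  j + ε * Real.log (1 / ε) * v (ε * (j - c3 * t)) (ε ^ 3 * Real.log (1 / ε) * t)

/-- The lattice error `R_ε(x,τ)` of the log-corrected ansatz for the
Calogero-type lattice with `α = 3` (forces `F ∼ r^{-4}`). -/
noncomputable def latticeErrorLog (v : ℝ → ℝ → ℝ) (ε x τ : ℝ) : ℝ :=
  let t := τ / (ε ^ 3 * Real.log (1 / ε))
  let j := x / ε + c3 * t
  iteratedDeriv 2 (fun t' => ansatzLog v ε j t') t
    + 3 * ∑' m : ℕ+, ((ansatzLog v ε (j + (m : ℝ)) t - ansatzLog v ε j t) ^ (-(4 : ℝ))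
        - (ansatzLog v ε j t - ansatzLog v ε (j - (m : ℝ)) t) ^ (-(4 : ℝ)))

lemma abs_sub_taylor_sum_le {f : ℝ → ℝ} {n : ℕ} {B : ℝ} (hf : ContDiff ℝ (n + 1) f)
    (hB : ∀ y, |iteratedDeriv (n + 1) f y| ≤ B) (x h : ℝ) :
    |f (x + h) - ∑ k ∈ Finset.range (n + 1), iteratedDeriv k f x * h ^ k / k.factorial|
      ≤ B * |h| ^ (n + 1) / (n + 1).factorial := by
  rcases eq_or_ne h 0 with rfl | hh
  · simp [Finset.sum_range_succ']
  obtain ⟨y, -, hy⟩ := taylor_mean_remainder_lagrange_iteratedDeriv (n := n)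
    (show x ≠ x + h by simpa using hh) hf.contDiffOn
  have hT : taylorWithinEval f n (Set.uIcc x (x + h)) x (x + h)
      = ∑ k ∈ Finset.range (n + 1), iteratedDeriv k f x * h ^ k / k.factorial := by
    rw [taylor_within_apply]
    refine Finset.sum_congr rfl fun k hk => ?_
    rw [iteratedDerivWithin_eq_iteratedDeriv (uniqueDiffOn_uIcc (by simpa using hh)) _
      Set.left_mem_uIcc, smul_eq_mul, add_sub_cancel_left]
    · ring
    · refine (hf.of_le ?_).contDiffAt
      exact_mod_cast (Finset.mem_range.mp hk).le
  rw [hT, add_sub_cancel_left] at hy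
  rw [hy, abs_div, abs_mul, abs_pow, Nat.abs_cast]
  gcongr
  exact hB y

/-- The function `y ↦ (1 + y)⁻⁴` agrees with its quadratic Taylor polynomial up to a function
with Lipschitz constant `O(r²)` on `[-r, r]`. -/
lemma exists_abs_inv_pow_four_sub_le :
    ∃ K : ℝ, 0 ≤ K ∧ ∀ r y z : ℝ, r ≤ 1 / 2 → |y| ≤ r → |z| ≤ r →
      |((1 + y) ^ 4)⁻¹ - ((1 + z) ^ 4)⁻¹ - (-4 * (y - z) + 10 * (y ^ 2 - z ^ 2))|
        ≤ K * r ^ 2 * |y - z| := by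
  refine ⟨10000, by norm_num, fun r y z hr hy hz => ?_⟩
  have hd : ∀ w ∈ Set.Icc (-r) r, HasDerivWithinAt
      (fun w : ℝ => ((1 + w) ^ 4)⁻¹ - (-4 * w + 10 * w ^ 2))
      (-4 * ((1 + w) ^ 5)⁻¹ + 4 - 20 * w) (Set.Icc (-r) r) w := by
    intro w hw
    have h0 : (1 + w) ≠ 0 := by linarith [hw.1]
    refine HasDerivAt.hasDerivWithinAt ?_
    have h1 := (((hasDerivAt_id' w).const_add 1).fun_pow 4).fun_inv (pow_ne_zero 4 h0)
    have h2 : HasDerivAt (fun w : ℝ => -4 * w + 10 * w ^ 2) (-4 + 10 * (2 * w)) w := by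
      simpa using ((hasDerivAt_id' w).const_mul (-4)).fun_add ((hasDerivAt_pow 2 w).const_mul 10)
    refine (h1.fun_sub h2).congr_deriv ?_
    simp
    field_simp
    ring
  have hb : ∀ w ∈ Set.Icc (-r) r, ‖-4 * ((1 + w) ^ 5)⁻¹ + 4 - 20 * w‖ ≤ 10000 * r ^ 2 := by
    intro w hw
    have hw' : |w| ≤ r := abs_le.mpr hw
    have h0 : 1 / 2 ≤ 1 + w := by linarith [hw.1]
    have h5 : (1 / 32 : ℝ) ≤ (1 + w) ^ 5 := by
      calc (1 / 32 : ℝ) = (1 / 2) ^ 5 := by norm_num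
        _ ≤ _ := by gcongr
    have e : -4 * ((1 + w) ^ 5)⁻¹ + 4 - 20 * w
        = w ^ 2 * (-60 - 160 * w - 180 * w ^ 2 - 96 * w ^ 3 - 20 * w ^ 4) * ((1 + w) ^ 5)⁻¹ := by
      have : (1 + w) ≠ 0 := by linarith
      field_simp
      ring
    have hw1 : |w| ≤ 1 := by linarith
    have hp : |-60 - 160 * w - 180 * w ^ 2 - 96 * w ^ 3 - 20 * w ^ 4| ≤ 300 := by
      obtain ⟨ha, hb⟩ := abs_le.mp (hw'.trans hr)
      rw [abs_le]
      constructor <;> nlinarith [sq_nonneg w, sq_nonneg (w ^ 2), sq_nonneg (w + 1),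
        sq_nonneg (w ^ 2 + w), mul_nonneg (sq_nonneg w) (sub_nonneg.mpr hb)]
    have hi : ((1 + w) ^ 5)⁻¹ ≤ 32 := by
      rw [inv_le_comm₀ (by positivity) (by norm_num)]; linarith
    rw [e, Real.norm_eq_abs, abs_mul, abs_mul, abs_of_nonneg (sq_nonneg w),
      abs_of_nonneg (show 0 ≤ ((1 + w) ^ 5)⁻¹ by positivity)]
    have hwr : w ^ 2 ≤ r ^ 2 := sq_le_sq' hw.1 hw.2
    calc _ ≤ r ^ 2 * 300 * 32 := by gcongr
      _ ≤ _ := by nlinarith [sq_nonneg r]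
  have := (convex_Icc (-r) r).norm_image_sub_le_of_norm_hasDerivWithin_le hd hb
    (abs_le.mp hz) (abs_le.mp hy)
  rw [Real.norm_eq_abs, Real.norm_eq_abs] at this
  convert this using 2
  ring

lemma summable_and_abs_tsum_le {e : ℕ → ℝ} {C : ℝ}
    (h : ∀ n, ∑ i ∈ Finset.range n, |e i| ≤ C) : Summable e ∧ |∑' i, e i| ≤ C := by
  have hs : Summable fun i => |e i| := summable_of_sum_range_le (fun _ => abs_nonneg _) h
  refine ⟨hs.of_abs, ?_⟩
  calc |∑' i, e i| ≤ ∑' i, |e i| := norm_tsum_le_tsum_norm (f := e) hs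
    _ ≤ C := Real.tsum_le_of_sum_range_le (fun _ => abs_nonneg _) h

lemma sum_range_inv_succ_sq_le (n : ℕ) :
    ∑ i ∈ Finset.range n, (((i : ℝ) + 1) ^ 2)⁻¹ ≤ 2 := by
  have := sum_Ioo_inv_sq_le (α := ℝ) 0 (n + 1)
  rw [← Finset.Ico_add_one_left_eq_Ioo, Finset.sum_Ico_eq_sum_range] at this
  simpa [add_comm] using this

/-- A tail bound `O(1/N²)` for `∑ 1/i³`. -/
lemma sum_range_ite_inv_succ_cube_le (N n : ℕ) :
    ∑ i ∈ Finset.range n, (if i < N then 0 else (((i : ℝ) + 1) ^ 3)⁻¹)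
      ≤ 2 * (((N : ℝ) + 1) ^ 2)⁻¹ := by
  have h := sum_Ioo_inv_sq_le (α := ℝ) N (n + 1)
  rw [← Finset.Ico_add_one_left_eq_Ioo, ← Finset.sum_Ico_add' (fun i : ℕ => ((i : ℝ) ^ 2)⁻¹)] at h
  calc ∑ i ∈ Finset.range n, (if i < N then 0 else (((i : ℝ) + 1) ^ 3)⁻¹)
      = ∑ i ∈ Finset.Ico N n, (((i : ℝ) + 1) ^ 3)⁻¹ := by
        rw [Finset.sum_ite, Finset.sum_const_zero, zero_add]
        congr 1
        ext i; simp; omega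
    _ ≤ ∑ i ∈ Finset.Ico N n, ((N : ℝ) + 1)⁻¹ * ((((i + 1 : ℕ) : ℝ)) ^ 2)⁻¹ := by
        refine Finset.sum_le_sum fun i hi => ?_
        rw [← mul_inv]
        have : (N : ℝ) ≤ i := by exact_mod_cast (Finset.mem_Ico.mp hi).1
        refine inv_anti₀ (by positivity) ?_
        push_cast
        rw [pow_succ' _ 2]
        gcongr
    _ ≤ ((N : ℝ) + 1)⁻¹ * (2 / ((N : ℝ) + 1)) := by
        rw [← Finset.mul_sum]
        gcongr
    _ = _ := by
        field_simp

lemma hasSum_zeta3 : HasSum (fun n : ℕ => (((n : ℝ) + 1) ^ 3)⁻¹) zeta3 := by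
  have e : ∀ n : ℕ, ((n : ℝ) + 1) ^ (-(3 : ℝ)) = (((n : ℝ) + 1) ^ 3)⁻¹ := fun n => by
    rw [Real.rpow_neg (by positivity)]
    norm_cast
  have hs : Summable fun n : ℕ => (((n : ℝ) + 1) ^ 3)⁻¹ := by
    have := (summable_nat_add_iff 1).mpr (Real.summable_nat_pow_inv.mpr (show 1 < 3 by norm_num))
    simpa using this
  have := hs.hasSum
  rwa [show ∑' n : ℕ, (((n : ℝ) + 1) ^ 3)⁻¹ = zeta3 from
    tsum_congr fun n => (e n).symm] at this

lemma sq_c3 : c3 ^ 2 = 12 * zeta3 := by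
  refine Real.sq_sqrt ?_
  have := hasSum_zeta3.nonneg fun n => by positivity
  positivity

/-- Taylor bounds for the forward and backward difference quotients of a function with bounded
derivatives. -/
lemma difference_quotient_bounds {f : ℝ → ℝ} {B : ℝ} (hf : ContDiff ℝ 5 f)
    (hB : ∀ n : ℕ, 1 ≤ n → n ≤ 5 → ∀ y, |iteratedDeriv n f y| ≤ B) (x : ℝ) {h p q : ℝ}
    (hh : 0 < h) (hp : p = (f (x + h) - f x) / h) (hq : q = (f x - f (x - h)) / h) :
    |p| ≤ B ∧ |q| ≤ B ∧ |p - q| ≤ B * h ∧ |p - q - h * iteratedDeriv 2 f x| ≤ B * h ^ 2 ∧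
      |p + q - 2 * iteratedDeriv 1 f x| ≤ B * h ∧
      |p - q - h * iteratedDeriv 2 f x - h ^ 3 / 12 * iteratedDeriv 4 f x| ≤ B * h ^ 4 := by
  have hB0 : 0 ≤ B := (abs_nonneg _).trans (hB 1 le_rfl (by norm_num) 0)
  have T : ∀ n : ℕ, n + 1 ≤ 5 → ∀ k : ℝ,
      |f (x + k) - ∑ i ∈ Finset.range (n + 1), iteratedDeriv i f x * k ^ i / i.factorial|
        ≤ B * |k| ^ (n + 1) / (n + 1).factorial := fun n hn k =>
    abs_sub_taylor_sum_le (hf.of_le (by exact_mod_cast hn)) (hB _ (by omega) hn) x k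
  have fp : f (x + h) = f x + h * p := by rw [hp]; field_simp; ring
  have fq : f (x + -h) = f x - h * q := by rw [hq, ← sub_eq_add_neg]; field_simp; ring
  have P := fun n hn => T n hn h
  have N := fun n hn => T n hn (-h)
  simp only [fp, fq, abs_neg, abs_of_pos hh] at P N
  have key : ∀ a b : ℝ, |h * a| ≤ h * b → |a| ≤ b := fun a b hab => by
    rw [abs_mul, abs_of_pos hh] at hab
    exact le_of_mul_le_mul_left hab hh
  have split : ∀ n (hn : n + 1 ≤ 5), _ ∧ _ ∧ _ ∧ _ := fun n hn =>
    ⟨(abs_le.mp (P n hn)).1, (abs_le.mp (P n hn)).2, (abs_le.mp (N n hn)).1, (abs_le.mp (N n hn)).2⟩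
  have c1 : 0 ≤ B * h := by positivity
  have c2 : 0 ≤ B * h ^ 2 := by positivity
  have c3 : 0 ≤ B * h ^ 3 := by positivity
  have c5 : 0 ≤ B * h ^ 5 := by positivity
  obtain ⟨h1, h2, h3, h4⟩ := split 0 (by norm_num)
  obtain ⟨h5, h6, h7, h8⟩ := split 1 (by norm_num)
  obtain ⟨h9, h10, h11, h12⟩ := split 2 (by norm_num)
  obtain ⟨h13, h14, h15, h16⟩ := split 4 (by norm_num)
  norm_num [Finset.sum_range_succ, Nat.factorial, -iteratedDeriv_one]
    at h1 h2 h3 h4 h5 h6 h7 h8 h9 h10 h11 h12 h13 h14 h15 h16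
  refine ⟨key _ _ ?_, key _ _ ?_, key _ _ ?_, key _ _ ?_, key _ _ ?_, key _ _ ?_⟩ <;>
    rw [abs_le] <;> constructor <;> linarith

/-- Asymptotics of the lattice force sum, written through relative displacements
`δ p`, `δ q` of the neighbours at distance `n + 1`. -/
lemma exists_abs_tsum_force_sub_le {f : ℝ → ℝ} {B : ℝ} (hf : ContDiff ℝ 5 f)
    (hB : ∀ n : ℕ, 1 ≤ n → n ≤ 5 → ∀ y, |iteratedDeriv n f y| ≤ B) (x : ℝ) :
    ∃ C : ℝ, ∀ ε δ : ℝ, 0 < ε → 0 < δ → δ * B ≤ 1 / 2 →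
      |∑' n : ℕ, (((n : ℝ) + 1) ^ 4)⁻¹ *
          (((1 + δ * ((f (x + ε * (n + 1)) - f x) / (ε * (n + 1)))) ^ 4)⁻¹
            - ((1 + δ * ((f x - f (x - ε * (n + 1))) / (ε * (n + 1)))) ^ 4)⁻¹)
        - ((-4 * δ * ε * iteratedDeriv 2 f x
            + 20 * δ ^ 2 * ε * iteratedDeriv 1 f x * iteratedDeriv 2 f x) * zeta3
          - δ * ε ^ 3 / 3 * iteratedDeriv 4 f x * harmonic ⌊1 / ε⌋₊)|
        ≤ C * (δ ^ 2 * ε ^ 2 + δ ^ 3 * ε + δ * ε ^ 3) := by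
  obtain ⟨K, hK0, hK⟩ := exists_abs_inv_pow_four_sub_le
  have hB0 : 0 ≤ B := (abs_nonneg _).trans (hB 1 le_rfl (by norm_num) 0)
  refine ⟨20 * B + 60 * B ^ 2 + 2 * K * B ^ 3, fun ε δ hε hδ hδB => ?_⟩
  set a₁ := iteratedDeriv 1 f x
  set a₂ := iteratedDeriv 2 f x
  set a₄ := iteratedDeriv 4 f x
  have ha₁ : |a₁| ≤ B := hB 1 (by norm_num) (by norm_num) x
  have ha₂ : |a₂| ≤ B := hB 2 (by norm_num) (by norm_num) x
  set N := ⌊1 / ε⌋₊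
  set p : ℕ → ℝ := fun n => (f (x + ε * (n + 1)) - f x) / (ε * (n + 1))
  set q : ℕ → ℝ := fun n => (f x - f (x - ε * (n + 1))) / (ε * (n + 1))
  set F : ℕ → ℝ := fun n =>
    (((n : ℝ) + 1) ^ 4)⁻¹ * (((1 + δ * p n) ^ 4)⁻¹ - ((1 + δ * q n) ^ 4)⁻¹) with hF
  set A : ℝ := -4 * δ * ε * a₂ + 20 * δ ^ 2 * ε * a₁ * a₂ with hA
  set H : ℕ → ℝ := fun n => if n < N then -(δ * ε ^ 3 / 3 * a₄) * ((n : ℝ) + 1)⁻¹ else 0 with hH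
  set e : ℕ → ℝ := fun n => F n - A * (((n : ℝ) + 1) ^ 3)⁻¹ - H n with he
  have hterm : ∀ n : ℕ, |e n| ≤ (if n < N then 4 * δ * B * ε ^ 4 else 0)
      + 8 * δ * B * ε * (if n < N then 0 else (((n : ℝ) + 1) ^ 3)⁻¹)
      + (30 * B ^ 2 * δ ^ 2 * ε ^ 2 + K * B ^ 3 * δ ^ 3 * ε) * (((n : ℝ) + 1) ^ 2)⁻¹ := by
    intro n
    have hm : (1 : ℝ) ≤ (n : ℝ) + 1 := by simp
    set m : ℝ := (n : ℝ) + 1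
    have hm0 : 0 < m := by linarith
    obtain ⟨b1, b2, b3, b4, b5, b6⟩ := difference_quotient_bounds hf hB x (h := ε * m)
      (p := p n) (q := q n) (by positivity) rfl rfl
    have hρ := hK (δ * B) (δ * p n) (δ * q n) hδB
      (by rw [abs_mul, abs_of_pos hδ]; gcongr) (by rw [abs_mul, abs_of_pos hδ]; gcongr)
    set ρ := ((1 + δ * p n) ^ 4)⁻¹ - ((1 + δ * q n) ^ 4)⁻¹
      - (-4 * (δ * p n - δ * q n) + 10 * ((δ * p n) ^ 2 - (δ * q n) ^ 2)) with hρd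
    have hρ' : |ρ| ≤ K * (δ * B) ^ 2 * (δ * (B * (ε * m))) := by
      refine hρ.trans ?_
      rw [← mul_sub, abs_mul, abs_of_pos hδ]
      gcongr
    have hS : |(p n - q n) * (p n + q n) - 2 * (ε * m) * a₁ * a₂| ≤ 3 * B ^ 2 * (ε * m) ^ 2 := by
      have hpq : |p n + q n| ≤ 2 * B := (abs_add_le _ _).trans (by linarith)
      calc _ = |(p n - q n - ε * m * a₂) * (p n + q n) + ε * m * a₂ * (p n + q n - 2 * a₁)| := by
            congr 1; ring
        _ ≤ (B * (ε * m) ^ 2) * (2 * B) + ε * m * B * (B * (ε * m)) := by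
            refine (abs_add_le _ _).trans ?_
            rw [abs_mul, abs_mul, abs_mul (ε * m), abs_of_pos (show 0 < ε * m by positivity)]
            gcongr
        _ = _ := by ring
    have hG : |(p n - q n - ε * m * a₂) - (if n < N then (ε * m) ^ 3 / 12 * a₄ else 0)|
        ≤ if n < N then B * (ε * m) ^ 4 else 2 * B * (ε * m) := by
      split_ifs
      · exact b6
      · rw [sub_zero]
        refine (abs_sub _ _).trans ?_
        rw [abs_mul, abs_of_pos (show 0 < ε * m by positivity)]
        nlinarith [mul_le_mul_of_nonneg_left ha₂ (show 0 ≤ ε * m by positivity)]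
    have hdec : e n = (m ^ 4)⁻¹ * (-4 * δ * ((p n - q n - ε * m * a₂)
          - (if n < N then (ε * m) ^ 3 / 12 * a₄ else 0))
        + 10 * δ ^ 2 * ((p n - q n) * (p n + q n) - 2 * (ε * m) * a₁ * a₂) + ρ) := by
      simp only [he, hF, hA, hH, hρd]
      split_ifs <;> field_simp <;> ring
    have hbd : |e n| ≤ (m ^ 4)⁻¹ * (4 * δ * (if n < N then B * (ε * m) ^ 4 else 2 * B * (ε * m))
        + 10 * δ ^ 2 * (3 * B ^ 2 * (ε * m) ^ 2) + K * (δ * B) ^ 2 * (δ * (B * (ε * m)))) := by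
      rw [hdec, abs_mul, abs_of_pos (show 0 < (m ^ 4)⁻¹ by positivity)]
      gcongr
      refine (abs_add_three _ _ _).trans ?_
      rw [abs_mul (-4 * δ), abs_mul (10 * δ ^ 2), abs_of_pos (show 0 < 10 * δ ^ 2 by positivity),
        show |-4 * δ| = 4 * δ by rw [abs_mul, abs_of_pos hδ]; norm_num]
      gcongr
    refine hbd.trans ?_
    have hinv : (m ^ 3)⁻¹ ≤ (m ^ 2)⁻¹ :=
      inv_anti₀ (by positivity) (pow_le_pow_right₀ hm (by norm_num))
    have hlast := mul_le_mul_of_nonneg_left hinv (show 0 ≤ K * B ^ 3 * δ ^ 3 * ε by positivity)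
    have hrew : (m ^ 4)⁻¹ * (4 * δ * (if n < N then B * (ε * m) ^ 4 else 2 * B * (ε * m))
        + 10 * δ ^ 2 * (3 * B ^ 2 * (ε * m) ^ 2) + K * (δ * B) ^ 2 * (δ * (B * (ε * m))))
      = (if n < N then 4 * δ * B * ε ^ 4 else 0)
        + 8 * δ * B * ε * (if n < N then 0 else (m ^ 3)⁻¹)
        + 30 * B ^ 2 * δ ^ 2 * ε ^ 2 * (m ^ 2)⁻¹ + K * B ^ 3 * δ ^ 3 * ε * (m ^ 3)⁻¹ := by
      split_ifs <;> field_simp <;> ring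
    rw [hrew]
    linarith
  obtain ⟨hes, heb⟩ := summable_and_abs_tsum_le (e := e)
    (C := (20 * B + 60 * B ^ 2 + 2 * K * B ^ 3) * (δ ^ 2 * ε ^ 2 + δ ^ 3 * ε + δ * ε ^ 3)) <| by
    intro n
    have s1 : ∑ i ∈ Finset.range n, (if i < N then 4 * δ * B * ε ^ 4 else 0)
        ≤ 4 * δ * B * ε ^ 3 := by
      have hNε : (N : ℝ) ≤ 1 / ε := Nat.floor_le (by positivity)
      have hcard : (((Finset.range n).filter (· < N)).card : ℝ) ≤ N := by
        have : ((Finset.range n).filter (· < N)) ⊆ Finset.range N := fun i hi => by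
          simp at hi ⊢; exact hi.2
        exact_mod_cast (Finset.card_le_card this).trans (Finset.card_range N).le
      rw [← Finset.sum_filter, Finset.sum_const, nsmul_eq_mul]
      calc _ ≤ 1 / ε * (4 * δ * B * ε ^ 4) := by
            gcongr
            exact hcard.trans hNε
        _ = _ := by field_simp
    have s2 := sum_range_ite_inv_succ_cube_le N n
    have s3 := sum_range_inv_succ_sq_le n
    have hN2 : (((N : ℝ) + 1) ^ 2)⁻¹ ≤ ε ^ 2 := by
      have : 1 / ε ≤ (N : ℝ) + 1 := (Nat.lt_floor_add_one _).le
      rw [inv_le_comm₀ (by positivity) (by positivity), ← inv_pow, ← one_div]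
      gcongr
    calc ∑ i ∈ Finset.range n, |e i| ≤ _ := Finset.sum_le_sum fun i _ => hterm i
      _ = ∑ i ∈ Finset.range n, (if i < N then 4 * δ * B * ε ^ 4 else 0)
          + 8 * δ * B * ε *
            ∑ i ∈ Finset.range n, (if i < N then 0 else (((i : ℝ) + 1) ^ 3)⁻¹)
          + (30 * B ^ 2 * δ ^ 2 * ε ^ 2 + K * B ^ 3 * δ ^ 3 * ε) *
            ∑ i ∈ Finset.range n, (((i : ℝ) + 1) ^ 2)⁻¹ := by
          rw [Finset.sum_add_distrib, Finset.sum_add_distrib, Finset.mul_sum, Finset.mul_sum]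
      _ ≤ 4 * δ * B * ε ^ 3 + 8 * δ * B * ε * (2 * ε ^ 2)
          + (30 * B ^ 2 * δ ^ 2 * ε ^ 2 + K * B ^ 3 * δ ^ 3 * ε) * 2 := by
          gcongr
          exact s2.trans (by linarith)
      _ = 20 * B * (δ * ε ^ 3) + 60 * B ^ 2 * (δ ^ 2 * ε ^ 2)
          + 2 * K * B ^ 3 * (δ ^ 3 * ε) := by ring
      _ ≤ _ := by
          have t1 : 0 ≤ δ ^ 2 * ε ^ 2 := by positivity
          have t2 : 0 ≤ δ ^ 3 * ε := by positivity
          have t3 : 0 ≤ δ * ε ^ 3 := by positivity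
          set X := δ ^ 2 * ε ^ 2
          set Y := δ ^ 3 * ε
          set Z := δ * ε ^ 3
          have : 0 ≤ 20 * B * (X + Y) + 60 * B ^ 2 * (Y + Z) + 2 * K * B ^ 3 * (X + Z) := by
            positivity
          linarith
  have hHs : HasSum H (-(δ * ε ^ 3 / 3 * a₄ * harmonic N)) := by
    have h0 : HasSum H (∑ n ∈ Finset.range N, H n) :=
      hasSum_sum_of_ne_finset_zero fun n hn => if_neg (by simpa using hn)
    convert h0 using 1
    rw [← neg_mul, harmonic, Rat.cast_sum, Finset.mul_sum]
    refine Finset.sum_congr rfl fun n hn => ?_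
    rw [hH]
    simp [Finset.mem_range.mp hn]
  have hsum := ((hasSum_zeta3.mul_left A).add hHs).add hes.hasSum
  have hFe : F = fun n : ℕ => A * (((n : ℝ) + 1) ^ 3)⁻¹ + H n + e n := by
    funext n; simp only [he]; ring
  have : ∑' n, F n = A * zeta3 + -(δ * ε ^ 3 / 3 * a₄ * harmonic N) + ∑' n, e n := by
    rw [hFe]; exact hsum.tsum_eq
  change |∑' n, F n - (A * zeta3 - δ * ε ^ 3 / 3 * a₄ * harmonic N)| ≤ _
  rw [this]
  convert heb using 2
  ring

section Line

variable {E : Type*} [NormedAddCommGroup E] [NormedSpace ℝ E] {V : E → ℝ}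

lemma hasDerivAt_comp_line {F : Type*} [NormedAddCommGroup F] [NormedSpace ℝ F] {g : E → F}
    (hg : Differentiable ℝ g) (z w : E) (t : ℝ) :
    HasDerivAt (fun s : ℝ => g (z + s • w)) (fderiv ℝ g (z + t • w) w) t := by
  have h : HasDerivAt (fun s : ℝ => z + s • w) w t := by
    simpa using ((hasDerivAt_id' t).smul_const w).const_add z
  exact (hg _).hasFDerivAt.comp_hasDerivAt t h

lemma deriv_fderiv_comp_line (hV : ContDiff ℝ 2 V) (z w w' : E) (t : ℝ) :
    deriv (fun s : ℝ => fderiv ℝ V (z + s • w) w') t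
      = fderiv ℝ (fderiv ℝ V) (z + t • w) w w' := by
  have hd : Differentiable ℝ (fderiv ℝ V) :=
    (hV.fderiv_right (m := 1) (by norm_num)).differentiable (by norm_num)
  exact ((hasDerivAt_comp_line hd z w t).clm_apply (hasDerivAt_const t w')).deriv.trans (by simp)

lemma iteratedDeriv_two_comp_line (hV : ContDiff ℝ 2 V) (z w : E) (t : ℝ) :
    iteratedDeriv 2 (fun s : ℝ => V (z + s • w)) t
      = fderiv ℝ (fderiv ℝ V) (z + t • w) w w := by
  rw [iteratedDeriv_succ, iteratedDeriv_one]
  have : deriv (fun s : ℝ => V (z + s • w)) = fun s => fderiv ℝ V (z + s • w) w :=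
    funext fun s => (hasDerivAt_comp_line (hV.differentiable (by norm_num)) z w s).deriv
  rw [this, deriv_fderiv_comp_line hV]

end Line

/-- Second derivative in time of the ansatz, in terms of the second derivatives of `v`. -/
lemma exists_iteratedDeriv_two_ansatzLog {v : ℝ → ℝ → ℝ}
    (hv : ContDiff ℝ (⊤ : ℕ∞) (Function.uncurry v)) (x τ : ℝ) :
    ∃ b : ℝ, ∀ ε j t : ℝ, ε * (j - c3 * t) = x → ε ^ 3 * Real.log (1 / ε) * t = τ →
      iteratedDeriv 2 (fun t' => ansatzLog v ε j t') t
        = ε ^ 3 * Real.log (1 / ε) * c3 ^ 2 * iteratedDeriv 2 (fun x' => v x' τ) x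
          - 2 * c3 * ε ^ 5 * Real.log (1 / ε) ^ 2
            * deriv (fun τ' => deriv (fun x' => v x' τ') x) τ
          + ε ^ 7 * Real.log (1 / ε) ^ 3 * b := by
  set V := Function.uncurry v with hVdef
  have hV : ContDiff ℝ 2 V := contDiff_infty.mp hv 2
  set D := fderiv ℝ (fderiv ℝ V) (x, τ) with hD
  refine ⟨D (0, 1) (0, 1), fun ε j t hx hτ => ?_⟩
  set L := Real.log (1 / ε)
  have hxx : iteratedDeriv 2 (fun x' => v x' τ) x = D (1, 0) (1, 0) := by
    have := iteratedDeriv_two_comp_line hV ((0 : ℝ), τ) (1, 0) x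
    simpa [V, Function.uncurry] using this
  have hxτ : deriv (fun τ' => deriv (fun x' => v x' τ') x) τ = D (0, 1) (1, 0) := by
    have h1 : (fun τ' => deriv (fun x' => v x' τ') x)
        = fun s : ℝ => fderiv ℝ V ((x, (0 : ℝ)) + s • ((0 : ℝ), (1 : ℝ))) (1, 0) := by
      funext s
      have := (hasDerivAt_comp_line (hV.differentiable (by norm_num)) ((0 : ℝ), s) (1, 0) x).deriv
      simpa [V, Function.uncurry] using this
    rw [h1, deriv_fderiv_comp_line hV]
    simp [hD]
  have hsymm : D (1, 0) (0, 1) = D (0, 1) (1, 0) :=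
    (hV.contDiffAt.isSymmSndFDerivAt (by simp)) _ _
  have htt : iteratedDeriv 2 (fun t' => ansatzLog v ε j t') t
      = ε * L * D (-(ε * c3), ε ^ 3 * L) (-(ε * c3), ε ^ 3 * L) := by
    have h := iteratedDeriv_two_comp_line hV (ε * j, (0 : ℝ)) (-(ε * c3), ε ^ 3 * L) t
    have hpt : (ε * j, (0 : ℝ)) + t • (-(ε * c3), ε ^ 3 * L) = (x, τ) := by
      ext <;> simp <;> linarith
    have hfun : (fun t' => ansatzLog v ε j t') = fun t' => j + (ε * L) *
        V ((ε * j, (0 : ℝ)) + t' • (-(ε * c3), ε ^ 3 * L)) := by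
      funext s
      simp only [ansatzLog, V, Function.uncurry, Prod.smul_mk, Prod.mk_add_mk, smul_eq_mul]
      congr 3 <;> ring
    rw [hpt] at h
    rw [hfun, iteratedDeriv_const_add (by norm_num), iteratedDeriv_const_mul_field, h]
  have hw : ((-(ε * c3), ε ^ 3 * L) : ℝ × ℝ)
      = (-(ε * c3)) • ((1 : ℝ), (0 : ℝ)) + (ε ^ 3 * L) • ((0 : ℝ), (1 : ℝ)) := by
    ext <;> simp
  rw [htt, hxx, hxτ, hw]
  simp only [map_add, map_smul, add_apply, smul_apply,
    smul_eq_mul, hsymm]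
  ring

/-- The force sum of the ansatz as a series over `ℕ` in terms of difference quotients. -/
lemma tsum_ansatzLog_force (v : ℝ → ℝ → ℝ) {ε x τ j t : ℝ} (hε : 0 < ε)
    (hx : ε * (j - c3 * t) = x) (hτ : ε ^ 3 * Real.log (1 / ε) * t = τ) :
    ∑' m : ℕ+, ((ansatzLog v ε (j + (m : ℝ)) t - ansatzLog v ε j t) ^ (-(4 : ℝ))
        - (ansatzLog v ε j t - ansatzLog v ε (j - (m : ℝ)) t) ^ (-(4 : ℝ)))
      = ∑' n : ℕ, (((n : ℝ) + 1) ^ 4)⁻¹ *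
          (((1 + ε ^ 2 * Real.log (1 / ε) *
              ((v (x + ε * (n + 1)) τ - v x τ) / (ε * (n + 1)))) ^ 4)⁻¹
            - ((1 + ε ^ 2 * Real.log (1 / ε) *
              ((v x τ - v (x - ε * (n + 1)) τ) / (ε * (n + 1)))) ^ 4)⁻¹) := by
  have hpow : ∀ y : ℝ, y ^ (-(4 : ℝ)) = (y ^ 4)⁻¹ := fun y => by
    rw [show (-(4 : ℝ)) = ((-4 : ℤ) : ℝ) by norm_num, Real.rpow_intCast]
    rfl
  have hdiff : ∀ a b : ℝ, b ≠ 0 →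
      ((b + ε * Real.log (1 / ε) * a) ^ 4)⁻¹
        = (b ^ 4)⁻¹ * ((1 + ε ^ 2 * Real.log (1 / ε) * (a / (ε * b))) ^ 4)⁻¹ := fun a b hb => by
    have hε' := hε.ne'
    rw [← mul_inv, ← mul_pow]
    congr 2
    field_simp
  have hshift : ∀ r : ℝ, ε * (j + r - c3 * t) = x + ε * r := fun r => by rw [← hx]; ring
  have hshift' : ∀ r : ℝ, ε * (j - r - c3 * t) = x - ε * r := fun r => by rw [← hx]; ring
  rw [tsum_pnat_eq_tsum_succ (f := fun n : ℕ =>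
    ((ansatzLog v ε (j + (n : ℝ)) t - ansatzLog v ε j t) ^ (-(4 : ℝ))
        - (ansatzLog v ε j t - ansatzLog v ε (j - (n : ℝ)) t) ^ (-(4 : ℝ))))]
  refine tsum_congr fun n => ?_
  have hn : (n : ℝ) + 1 ≠ 0 := by positivity
  simp only [ansatzLog, hτ, hx, hshift, hshift', hpow, Nat.cast_add, Nat.cast_one]
  rw [mul_sub, ← hdiff _ _ hn, ← hdiff _ _ hn]
  congr 3 <;> ring

lemma tendsto_sq_mul_log_inv :
    Tendsto (fun ε : ℝ => ε ^ 2 * Real.log (1 / ε)) (𝓝[>] 0) (𝓝 0) := by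
  have := (tendsto_log_mul_rpow_nhdsGT_zero (r := 2) (by norm_num)).neg
  rw [neg_zero] at this
  refine this.congr fun ε => ?_
  rw [Real.rpow_ofNat, one_div, Real.log_inv]
  ring

lemma isLittleO_log_correction :
    (fun ε : ℝ => ε ^ 7 * Real.log (1 / ε) ^ 3 + ε ^ 5 * Real.log (1 / ε)
      + ε ^ 6 * Real.log (1 / ε) ^ 2) =o[𝓝[>] 0] fun ε : ℝ => ε ^ 5 * Real.log (1 / ε) ^ 2 := by
  have hlog : Tendsto (fun ε : ℝ => (Real.log (1 / ε))⁻¹) (𝓝[>] 0) (𝓝 0) := by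
    have := (Real.tendsto_log_atTop.comp tendsto_inv_nhdsGT_zero).inv_tendsto_atTop
    refine this.congr fun ε => ?_
    simp
  have hid : Tendsto (fun ε : ℝ => ε) (𝓝[>] 0) (𝓝 0) := nhdsWithin_le_nhds
  have hφ := (tendsto_sq_mul_log_inv.add hlog).add hid
  simp only [add_zero] at hφ
  have h := ((Asymptotics.isLittleO_one_iff ℝ).mpr hφ).mul_isBigO
    (Asymptotics.isBigO_refl (fun ε : ℝ => ε ^ 5 * Real.log (1 / ε) ^ 2) (𝓝[>] 0))
  refine h.congr' ?_ (by simp)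
  filter_upwards [Ioo_mem_nhdsGT one_pos] with ε ⟨hε, hε1⟩
  have hL : 0 < Real.log (1 / ε) := Real.log_pos (by rwa [lt_div_iff₀ hε, one_mul])
  field_simp

/-- **Log-corrected KdV limit in the edge case `α = 3`.**
Under the logarithmically corrected scaling the lattice error satisfies
`R_ε(x,τ) = ε⁵ log²(1/ε) (Q(x,τ) + o(1))` as `ε → 0⁺`, with
`Q = 2c₃ ∂_τ u + 60 ζ(3) u ∂_x u + ∂_x³ u`, `u = −∂_x v`. -/
theorem longwave_KdV_log_correction (v : ℝ → ℝ → ℝ)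
    (hsmooth : ContDiff ℝ (⊤ : ℕ∞) (Function.uncurry v))
    (hL2 : ∃ M : ℝ, ∀ n : ℕ, 1 ≤ n → n ≤ 5 → ∀ τ : ℝ,
      Integrable (fun x : ℝ => (iteratedDeriv n (fun x' => v x' τ) x) ^ 2) ∧
      ∫ x : ℝ, (iteratedDeriv n (fun x' => v x' τ) x) ^ 2 ≤ M)
    (hbdd : ∃ B : ℝ, ∀ n : ℕ, 1 ≤ n → n ≤ 5 → ∀ x τ : ℝ,
      |iteratedDeriv n (fun x' => v x' τ) x| ≤ B)
    (u : ℝ → ℝ → ℝ) (hu : ∀ x τ : ℝ, u x τ = -(deriv (fun x' => v x' τ) x))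
    (Q : ℝ → ℝ → ℝ)
    (hQ : ∀ x τ : ℝ, Q x τ = 2 * c3 * deriv (fun τ' => u x τ') τ
      + 60 * zeta3 * u x τ * deriv (fun x' => u x' τ) x
      + iteratedDeriv 3 (fun x' => u x' τ) x) :
    ∀ x τ : ℝ,
      (fun ε : ℝ => latticeErrorLog v ε x τ - ε ^ 5 * Real.log (1 / ε) ^ 2 * Q x τ)
        =o[nhdsWithin 0 (Set.Ioi 0)] (fun ε : ℝ => ε ^ 5 * Real.log (1 / ε) ^ 2) := by
  intro x τ
  obtain ⟨B, hB⟩ := hbdd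
  have hf : ContDiff ℝ 5 (fun x' => v x' τ) :=
    (contDiff_infty.mp hsmooth 5).comp (contDiff_id.prodMk contDiff_const)
  obtain ⟨C, hC⟩ := exists_abs_tsum_force_sub_le hf (fun n h1 h5 y => hB n h1 h5 y τ) x
  obtain ⟨b, hb⟩ := exists_iteratedDeriv_two_ansatzLog hsmooth x τ
  set f : ℝ → ℝ := fun x' => v x' τ with hfd
  have hQ' : Q x τ = -(2 * c3 * deriv (fun τ' => deriv (fun x' => v x' τ') x) τ)
      + 60 * zeta3 * iteratedDeriv 1 f x * iteratedDeriv 2 f x - iteratedDeriv 4 f x := by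
    have hux : (fun x' => u x' τ) = -deriv f := funext fun y => hu y τ
    have huτ : (fun τ' => u x τ') = -fun τ' => deriv (fun x' => v x' τ') x :=
      funext fun s => hu x s
    rw [hQ, hu, hux, huτ, iteratedDeriv_neg, deriv.neg', deriv.neg', iteratedDeriv_succ' (n := 3),
      iteratedDeriv_succ (n := 1), iteratedDeriv_one]
    simp only [← hfd]
    ring
  refine Asymptotics.IsBigO.trans_isLittleO (Asymptotics.IsBigO.of_bound (|b| + B + 3 * |C|) ?_)
    isLittleO_log_correction
  have hsmall : ∀ᶠ ε : ℝ in 𝓝[>] 0, ε ^ 2 * Real.log (1 / ε) * B < 1 / 2 := by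
    have := tendsto_sq_mul_log_inv.mul_const B
    rw [zero_mul] at this
    exact this.eventually_lt_const (by norm_num)
  filter_upwards [hsmall, Ioo_mem_nhdsGT one_pos] with ε hδB ⟨hε, hε1⟩
  have h1ε : 1 < 1 / ε := by rwa [lt_div_iff₀ hε, one_mul]
  have hL : 0 < Real.log (1 / ε) := Real.log_pos h1ε
  have hH0 := log_le_harmonic_floor (1 / ε) (by positivity)
  have hH1 := harmonic_floor_le_one_add_log (1 / ε) h1ε.le
  set t := τ / (ε ^ 3 * Real.log (1 / ε)) with ht
  have hτ : ε ^ 3 * Real.log (1 / ε) * t = τ := by rw [ht]; field_simp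
  have hx : ε * (x / ε + c3 * t - c3 * t) = x := by field_simp; ring
  have hF := hC ε (ε ^ 2 * Real.log (1 / ε)) hε (by positivity) hδB.le
  have hR : latticeErrorLog v ε x τ = _ + 3 * _ :=
    congrArg₂ (fun a b => a + 3 * b) (hb ε _ t hx hτ) (tsum_ansatzLog_force v hε hx hτ)
  rw [hR, hQ', sq_c3]
  set L := Real.log (1 / ε)
  set h := ((harmonic ⌊1 / ε⌋₊ : ℚ) : ℝ)
  set S := ∑' n : ℕ, (((n : ℝ) + 1) ^ 4)⁻¹ * _
  set M := (-4 * (ε ^ 2 * L) * ε * iteratedDeriv 2 f x + 20 * (ε ^ 2 * L) ^ 2 * ε *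
    iteratedDeriv 1 f x * iteratedDeriv 2 f x) * zeta3
    - ε ^ 2 * L * ε ^ 3 / 3 * iteratedDeriv 4 f x * h with hM
  have ha₄ : |iteratedDeriv 4 f x| ≤ B := hB 4 (by norm_num) (by norm_num) x τ
  have hB0 : 0 ≤ B := (abs_nonneg _).trans ha₄
  have hhL : |h - L| ≤ 1 := abs_le.mpr ⟨by linarith, by linarith⟩
  have hdec : ε ^ 3 * L * (12 * zeta3) * iteratedDeriv 2 f x
          - 2 * c3 * ε ^ 5 * L ^ 2 * deriv (fun τ' => deriv (fun x' => v x' τ') x) τ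
          + ε ^ 7 * L ^ 3 * b + 3 * S
        - ε ^ 5 * L ^ 2 * (-(2 * c3 * deriv (fun τ' => deriv (fun x' => v x' τ') x) τ)
          + 60 * zeta3 * iteratedDeriv 1 f x * iteratedDeriv 2 f x - iteratedDeriv 4 f x)
      = ε ^ 7 * L ^ 3 * b + -(ε ^ 5 * L * (iteratedDeriv 4 f x * (h - L))) + 3 * (S - M) := by
    rw [hM]; ring
  have hG : 0 ≤ ε ^ 7 * L ^ 3 + ε ^ 5 * L + ε ^ 6 * L ^ 2 := by positivity
  rw [hdec, Real.norm_eq_abs, Real.norm_eq_abs, abs_of_nonneg hG]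
  refine (abs_add_three _ _ _).trans ?_
  have h1 : |ε ^ 7 * L ^ 3 * b| ≤ |b| * (ε ^ 7 * L ^ 3 + ε ^ 5 * L + ε ^ 6 * L ^ 2) := by
    rw [abs_mul, abs_of_pos (show 0 < ε ^ 7 * L ^ 3 by positivity), mul_comm]
    gcongr
    linarith [show 0 < ε ^ 5 * L by positivity, show 0 < ε ^ 6 * L ^ 2 by positivity]
  have h2 : |-(ε ^ 5 * L * (iteratedDeriv 4 f x * (h - L)))|
      ≤ B * (ε ^ 7 * L ^ 3 + ε ^ 5 * L + ε ^ 6 * L ^ 2) := by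
    rw [abs_neg, abs_mul, abs_mul (iteratedDeriv 4 f x),
      abs_of_pos (show 0 < ε ^ 5 * L by positivity)]
    calc ε ^ 5 * L * (|iteratedDeriv 4 f x| * |h - L|) ≤ ε ^ 5 * L * (B * 1) := by gcongr
      _ = B * (ε ^ 5 * L) := by ring
      _ ≤ _ := by
        gcongr
        linarith [show 0 < ε ^ 7 * L ^ 3 by positivity, show 0 < ε ^ 6 * L ^ 2 by positivity]
  have h3 : |3 * (S - M)| ≤ 3 * |C| * (ε ^ 7 * L ^ 3 + ε ^ 5 * L + ε ^ 6 * L ^ 2) := by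
    rw [abs_mul, abs_of_pos (show (0 : ℝ) < 3 by norm_num), mul_assoc]
    gcongr
    calc |S - M| ≤ C * (ε ^ 7 * L ^ 3 + ε ^ 5 * L + ε ^ 6 * L ^ 2) := by
          refine hF.trans_eq ?_
          ring
      _ ≤ _ := by gcongr; exact le_abs_self C
  linarith
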